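/- Under assumption (A4), for every t ≥ 1 and coordinate i ∈ [d], the AdaGrad accumulator satisfies E[√v_{t,i}] ≤ √2·σ_i·t^{1/p} + E[√(2u_{t,i})], where u_{t,i} = ∑_{s=1}^t (∇_i f(x_s))². -/

import Mathlib

open MeasureTheory Finset

/-- The AdaGrad accumulator `v_{t,i} = ∑_{s=1}^t g_{s,i}²`. -/
noncomputable def adaV {Ω : Type} {d : ℕ} (g : ℕ → Ω → EuclideanSpace ℝ (Fin d))
    (t : ℕ) (ω : Ω) (i : Fin d) : ℝ :=
  ∑ s ∈ Finset.Icc 1 t, (g s ω i) ^ 2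

/-- The natural filtration `F_t = σ(g_1, …, g_t)`. -/
noncomputable def natFilt {Ω : Type} [MeasurableSpace Ω] {d : ℕ}
    (g : ℕ → Ω → EuclideanSpace ℝ (Fin d)) (t : ℕ) : MeasurableSpace Ω :=
  ⨆ s ∈ Finset.Icc 1 t, MeasurableSpace.comap (g s) inferInstance

/-- Monotonicity of `ℓ^p` norms: the `ℓ²` norm is at most the `ℓ^p` norm when `0 < p ≤ 2`. -/
lemma sqrt_sum_sq_le_rpow_sum_abs_rpow {ι : Type*} (s : Finset ι) (a : ι → ℝ) {p : ℝ}
    (hp0 : 0 < p) (hp2 : p ≤ 2) :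
    √(∑ k ∈ s, a k ^ 2) ≤ (∑ k ∈ s, |a k| ^ p) ^ (1 / p) := by
  have hsum : 0 ≤ ∑ k ∈ s, a k ^ 2 := Finset.sum_nonneg fun k _ => sq_nonneg _
  have hsub : (∑ k ∈ s, a k ^ 2) ^ (p / 2) ≤ ∑ k ∈ s, (a k ^ 2) ^ (p / 2) :=
    Finset.le_sum_of_subadditive_on_pred (fun y : ℝ => y ^ (p / 2)) (fun y => 0 ≤ y)
      (by simp [Real.zero_rpow (by positivity : p / 2 ≠ 0)])
      (fun x y hx hy => Real.rpow_add_le_add_rpow hx hy (by positivity) (by linarith))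
      (fun x y hx hy => add_nonneg hx hy) (fun k => a k ^ 2) fun k _ => sq_nonneg _
  have hterm : ∀ k ∈ s, (a k ^ 2) ^ (p / 2) = |a k| ^ p := fun k _ => by
    rw [← sq_abs, ← Real.rpow_natCast, ← Real.rpow_mul (abs_nonneg _)]
    congr 1
    push_cast
    ring
  rw [Finset.sum_congr rfl hterm] at hsub
  calc √(∑ k ∈ s, a k ^ 2) = ((∑ k ∈ s, a k ^ 2) ^ (p / 2)) ^ (1 / p) := by
        rw [Real.sqrt_eq_rpow, ← Real.rpow_mul hsum]
        congr 1
        field_simp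
    _ ≤ _ := by gcongr

lemma sqrt_sum_sq_le_add {ι : Type*} (s : Finset ι) (a b : ι → ℝ) :
    √(∑ k ∈ s, a k ^ 2) ≤ √2 * √(∑ k ∈ s, (a k - b k) ^ 2) + √(2 * ∑ k ∈ s, b k ^ 2) := by
  rw [← Real.sqrt_mul zero_le_two]
  set A := ∑ k ∈ s, (a k - b k) ^ 2 with hA
  set B := ∑ k ∈ s, b k ^ 2 with hB
  have hA0 : 0 ≤ 2 * A := mul_nonneg zero_le_two (Finset.sum_nonneg fun k _ => sq_nonneg _)
  have hB0 : 0 ≤ 2 * B := mul_nonneg zero_le_two (Finset.sum_nonneg fun k _ => sq_nonneg _)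
  have hle : ∑ k ∈ s, a k ^ 2 ≤ 2 * A + 2 * B := by
    rw [hA, hB, Finset.mul_sum, Finset.mul_sum, ← Finset.sum_add_distrib]
    exact Finset.sum_le_sum fun k _ => by nlinarith [sq_nonneg (a k - 2 * b k)]
  refine Real.sqrt_le_iff.2 ⟨by positivity, hle.trans ?_⟩
  nlinarith [Real.sq_sqrt hA0, Real.sq_sqrt hB0,
    mul_nonneg (Real.sqrt_nonneg (2 * A)) (Real.sqrt_nonneg (2 * B))]

/-- Jensen's inequality for the concave power `y ↦ y ^ r`, including integrability. -/
lemma integrable_rpow_and_integral_rpow_le {Ω : Type*} [MeasurableSpace Ω] {μ : Measure Ω}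
    [IsProbabilityMeasure μ] {W : Ω → ℝ} (hW : Integrable W μ) (hW0 : ∀ ω, 0 ≤ W ω) {r : ℝ}
    (hr0 : 0 ≤ r) (hr1 : r ≤ 1) :
    Integrable (fun ω => W ω ^ r) μ ∧ ∫ ω, W ω ^ r ∂μ ≤ (∫ ω, W ω ∂μ) ^ r := by
  have hint : Integrable (fun ω => W ω ^ r) μ := by
    refine ((integrable_const (1 : ℝ)).add hW).mono'
      (hW.aemeasurable.pow_const r).aestronglyMeasurable (ae_of_all _ fun ω => ?_)
    rw [Real.norm_of_nonneg (Real.rpow_nonneg (hW0 ω) r)]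
    calc W ω ^ r ≤ (1 + W ω) ^ r := by
          have := hW0 ω
          gcongr
          linarith
      _ ≤ (1 + W ω) ^ (1 : ℝ) :=
          Real.rpow_le_rpow_of_exponent_le (by linarith [hW0 ω]) hr1
      _ = 1 + W ω := Real.rpow_one _
  exact ⟨hint, (Real.concaveOn_rpow hr0 hr1).le_map_integral
    (Real.continuous_rpow_const hr0).continuousOn isClosed_Ici (ae_of_all _ hW0) hW hint⟩

lemma measurable_of_hasGradientAt {F : Type*} [NormedAddCommGroup F] [InnerProductSpace ℝ F]
    [CompleteSpace F] [MeasurableSpace F] [BorelSpace F] {f : F → ℝ} {f' : F → F}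
    (h : ∀ y, HasGradientAt f (f' y) y) : Measurable f' := by
  have heq : f' = fun y => (InnerProductSpace.toDual ℝ F).symm (fderiv ℝ f y) :=
    funext fun y => (h y).gradient.symm
  borelize (StrongDual ℝ F)
  rw [heq]
  exact (InnerProductSpace.toDual ℝ F).symm.continuous.measurable.comp (measurable_fderiv ℝ f)

lemma natFilt_le {Ω : Type} [mΩ : MeasurableSpace Ω] {d : ℕ}
    {g : ℕ → Ω → EuclideanSpace ℝ (Fin d)} (hg : ∀ t, Measurable (g t)) (t : ℕ) :
    natFilt g t ≤ mΩ :=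
  iSup₂_le fun s _ => (hg s).comap_le

/-- The almost sure bound on a conditional expectation bounds the expectation. -/
lemma integral_le_of_condExp_le {Ω : Type*} {m mΩ : MeasurableSpace Ω} {μ : Measure Ω}
    [IsProbabilityMeasure μ] (hm : m ≤ mΩ) {X : Ω → ℝ} {c : ℝ}
    (h : ∀ᵐ ω ∂μ, (μ[X | m]) ω ≤ c) : ∫ ω, X ω ∂μ ≤ c := by
  rw [← integral_condExp hm]
  calc ∫ ω, (μ[X | m]) ω ∂μ ≤ ∫ _, c ∂μ :=
        integral_mono_ae integrable_condExp (integrable_const c) h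
    _ = c := by simp

lemma measurable_adaV {Ω : Type} [MeasurableSpace Ω] {d : ℕ}
    {g : ℕ → Ω → EuclideanSpace ℝ (Fin d)} (hg : ∀ t, Measurable (g t)) (t : ℕ) (i : Fin d) :
    Measurable fun ω => adaV g t ω i := by
  unfold adaV
  fun_prop

/-- The iterates of AdaGrad are measurable. -/
lemma measurable_adaGrad_iterate {Ω : Type} [MeasurableSpace Ω] {d : ℕ}
    {g x : ℕ → Ω → EuclideanSpace ℝ (Fin d)} {x₁ : EuclideanSpace ℝ (Fin d)} {γ lam : ℝ}
    (hg : ∀ t, Measurable (g t)) (hx1 : ∀ ω, x 1 ω = x₁)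
    (hxupd : ∀ t, 1 ≤ t → ∀ ω (i : Fin d),
      x (t + 1) ω i = x t ω i - γ * g t ω i / (lam + √(adaV g t ω i)))
    {t : ℕ} (ht : 1 ≤ t) : Measurable (x t) := by
  induction t, ht using Nat.le_induction with
  | base => rw [show x 1 = fun _ => x₁ from funext hx1]; exact measurable_const
  | succ t ht ih =>
    have hcoord : Measurable fun ω i => x (t + 1) ω i := by
      refine measurable_pi_lambda _ fun i => ?_
      simp only [hxupd t ht]
      have := measurable_adaV hg t i
      fun_prop
    exact (WithLp.measurable_toLp 2 (Fin d → ℝ)).comp hcoord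

/-- under the heavy-tailed noise assumption (A4), for every `t ≥ 1`
and coordinate `i`, the AdaGrad accumulator satisfies
`E[√v_{t,i}] ≤ √2·σ_i·t^{1/p} + E[√(2 u_{t,i})]` with
`u_{t,i} = ∑_{s=1}^t (∇_i f(x_s))²`. -/
theorem adagrad_accumulator_bound
    (d : ℕ) (Ω : Type) [MeasurableSpace Ω] (μ : Measure Ω) [IsProbabilityMeasure μ]
    (f : EuclideanSpace ℝ (Fin d) → ℝ)
    (gradf : EuclideanSpace ℝ (Fin d) → EuclideanSpace ℝ (Fin d))
    (g x : ℕ → Ω → EuclideanSpace ℝ (Fin d)) (x₁ : EuclideanSpace ℝ (Fin d))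
    (γ lam p : ℝ) (σ : Fin d → ℝ)
    (hγ : 0 < γ) (hlam : 0 < lam)
    (hgrad : ∀ y, HasGradientAt f (gradf y) y)
    (hgmeas : ∀ t, Measurable (g t))
    (hx1 : ∀ ω, x 1 ω = x₁)
    (hxupd : ∀ t, 1 ≤ t → ∀ ω (i : Fin d),
      x (t + 1) ω i = x t ω i - γ * g t ω i / (lam + Real.sqrt (adaV g t ω i)))
    (hp1 : 1 < p) (hp2 : p ≤ 2) (hσ : ∀ i, 0 ≤ σ i)
    (hnoise : ∀ t, 1 ≤ t → ∀ i : Fin d,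
      Integrable (fun ω => |g t ω i - gradf (x t ω) i| ^ p) μ ∧
      ∀ᵐ ω ∂μ,
        (μ[(fun ω' => |g t ω' i - gradf (x t ω') i| ^ p) | natFilt g (t - 1)]) ω ≤ σ i ^ p) :
    ∀ t : ℕ, 1 ≤ t → ∀ i : Fin d,
      (∫ ω, Real.sqrt (adaV g t ω i) ∂μ) ≤
        Real.sqrt 2 * σ i * (t : ℝ) ^ (1 / p) +
          ∫ ω, Real.sqrt (2 * ∑ s ∈ Finset.Icc 1 t, (gradf (x s ω) i) ^ 2) ∂μ := by
  intro t ht i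
  have hp0 : 0 < p := by linarith
  have hgradm := measurable_of_hasGradientAt hgrad
  have hum : Measurable fun ω => √(2 * ∑ s ∈ Finset.Icc 1 t, gradf (x s ω) i ^ 2) := by
    refine ((Finset.measurable_sum _ fun s hs => ?_).const_mul 2).sqrt
    have hxs := measurable_adaGrad_iterate hgmeas hx1 hxupd (Finset.mem_Icc.1 hs).1
    have := hgradm.comp hxs
    exact (by fun_prop : Measurable fun ω => (gradf ∘ x s) ω i ^ 2)
  set W : Ω → ℝ := fun ω => ∑ s ∈ Finset.Icc 1 t, |g s ω i - gradf (x s ω) i| ^ p with hWdef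
  have hW0 : ∀ ω, 0 ≤ W ω := fun ω => Finset.sum_nonneg fun s _ => by positivity
  have hWint : Integrable W μ :=
    integrable_finsetSum _ fun s hs => (hnoise s (Finset.mem_Icc.1 hs).1 i).1
  have hWle : ∫ ω, W ω ∂μ ≤ t * σ i ^ p := by
    rw [hWdef, integral_finsetSum _ fun s hs => (hnoise s (Finset.mem_Icc.1 hs).1 i).1]
    refine (Finset.sum_le_card_nsmul _ _ (σ i ^ p) fun s hs => ?_).trans_eq (by simp)
    exact integral_le_of_condExp_le (natFilt_le hgmeas _) (hnoise s (Finset.mem_Icc.1 hs).1 i).2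
  obtain ⟨hRint, hRle⟩ := integrable_rpow_and_integral_rpow_le hWint hW0
    (r := 1 / p) (by positivity) ((div_le_one hp0).2 hp1.le)
  have hRbound : ∫ ω, W ω ^ (1 / p) ∂μ ≤ σ i * (t : ℝ) ^ (1 / p) := by
    have hσp : 0 ≤ σ i ^ p := Real.rpow_nonneg (hσ i) p
    calc ∫ ω, W ω ^ (1 / p) ∂μ ≤ (∫ ω, W ω ∂μ) ^ (1 / p) := hRle
      _ ≤ (t * σ i ^ p) ^ (1 / p) :=
          Real.rpow_le_rpow (integral_nonneg hW0) hWle (by positivity)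
      _ = σ i * (t : ℝ) ^ (1 / p) := by
          rw [Real.mul_rpow (by positivity) hσp, ← Real.rpow_mul (hσ i),
            mul_one_div_cancel hp0.ne', Real.rpow_one, mul_comm]
  have hv_le : ∀ ω, √(adaV g t ω i) ≤
      √2 * W ω ^ (1 / p) + √(2 * ∑ s ∈ Finset.Icc 1 t, gradf (x s ω) i ^ 2) := fun ω =>
    (sqrt_sum_sq_le_add _ (fun s => g s ω i) fun s => gradf (x s ω) i).trans <| by
      gcongr
      exact sqrt_sum_sq_le_rpow_sum_abs_rpow _ _ hp0 hp2
  have hu_le : ∀ ω, √(2 * ∑ s ∈ Finset.Icc 1 t, gradf (x s ω) i ^ 2) ≤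
      √2 * (√2 * W ω ^ (1 / p) + √2 * √(adaV g t ω i)) := fun ω => by
    rw [Real.sqrt_mul zero_le_two, ← Real.sqrt_mul zero_le_two (adaV g t ω i)]
    gcongr
    refine (sqrt_sum_sq_le_add _ (fun s => gradf (x s ω) i) fun s => g s ω i).trans ?_
    unfold adaV
    gcongr
    refine (sqrt_sum_sq_le_rpow_sum_abs_rpow _ _ hp0 hp2).trans_eq ?_
    simp only [hWdef, abs_sub_comm]
  by_cases hv : Integrable (fun ω => √(adaV g t ω i)) μ
  · have hu : Integrable (fun ω => √(2 * ∑ s ∈ Finset.Icc 1 t, gradf (x s ω) i ^ 2)) μ :=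
      (((hRint.const_mul √2).add (hv.const_mul √2)).const_mul √2).mono'
        hum.aestronglyMeasurable (ae_of_all _ fun ω => by
          rw [Real.norm_of_nonneg (Real.sqrt_nonneg _)]
          exact hu_le ω)
    refine (integral_mono hv ((hRint.const_mul √2).add hu) hv_le).trans ?_
    simp only [Pi.add_apply]
    rw [integral_add (hRint.const_mul _) hu, integral_const_mul, mul_assoc]
    gcongr
  · rw [integral_undef hv]
    have := hσ i
    exact add_nonneg (by positivity) (integral_nonneg fun ω => Real.sqrt_nonneg _)
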